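/- arXiv:math/0108152 — 2 statements merged into one kernel-verified Lean document; each statement's English description precedes it below -/
import Mathlib

section
/- Suppose θ ∈ ℝ is not a Stokes direction, and set λ := Re(e^{−i(k−1)θ}·A₀) ∈ t_ℝ. Then for every root α ∈ R: α(λ) > 0 if and only if there exists an anti-Stokes direction d ∈ ℝ supported by α with |d − θ| < π/(2k−2). In other words, the positive roots for the ordering determined by λ are precisely the roots supporting some anti-Stokes direction within π/(2k−2) of θ. -/
/-!
Context: `t_ℝ` is a finite-dimensional real vector space `V`; an element of its
complexification `t = ℂ ⊗ t_ℝ` is encoded by its real and imaginary parts `X Y : V`,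
so that a root `α : V →ₗ[ℝ] ℝ` evaluates complex-linearly on `A₀ = X + iY` as
`cval X Y α = α X + i·(α Y)`.
-/

/-- The complex-linear evaluation `α(A₀)` where `A₀ = X + iY`. -/
noncomputable def cval {V : Type*} [AddCommGroup V] [Module ℝ V]
    (X Y : V) (α : V →ₗ[ℝ] ℝ) : ℂ :=
  (α X : ℂ) + Complex.I * (α Y : ℂ)

/-- `θ` is an anti-Stokes direction supported by the root `α`:
`α(A₀)·e^{−i(k−1)θ}` is a positive real number. -/
noncomputable def Supports {V : Type*} [AddCommGroup V] [Module ℝ V]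
    (k : ℕ) (X Y : V) (α : V →ₗ[ℝ] ℝ) (θ : ℝ) : Prop :=
  ∃ r : ℝ, 0 < r ∧
    cval X Y α * Complex.exp (-Complex.I * ((k : ℂ) - 1) * (θ : ℂ)) = (r : ℂ)

/-- `θ` is an anti-Stokes direction: it is supported by some root in `R`. -/
noncomputable def IsAntiStokes {V : Type*} [AddCommGroup V] [Module ℝ V]
    (k : ℕ) (R : Finset (V →ₗ[ℝ] ℝ)) (X Y : V) (θ : ℝ) : Prop :=
  ∃ α ∈ R, Supports k X Y α θ

/-- `θ` is a Stokes direction: `θ − π/(2k−2)` is an anti-Stokes direction. -/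
noncomputable def IsStokes {V : Type*} [AddCommGroup V] [Module ℝ V]
    (k : ℕ) (R : Finset (V →ₗ[ℝ] ℝ)) (X Y : V) (θ : ℝ) : Prop :=
  IsAntiStokes k R X Y (θ - Real.pi / (2 * (k : ℝ) - 2))


/-- A root supports `d` iff `α(A₀)` has polar form `r·e^{i(k−1)d}` with `r > 0`. -/
lemma supports_iff_polar {V : Type*} [AddCommGroup V] [Module ℝ V]
    (k : ℕ) (X Y : V) (α : V →ₗ[ℝ] ℝ) (d : ℝ) :
    Supports k X Y α d ↔
      ∃ r : ℝ, 0 < r ∧ α X = r * Real.cos (((k : ℝ) - 1) * d) ∧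
        α Y = r * Real.sin (((k : ℝ) - 1) * d) := by
  unfold Supports
  refine exists_congr fun r => and_congr_right fun _ => ?_
  have hexp : Complex.exp (-Complex.I * ((k : ℂ) - 1) * (d : ℂ)) =
      (Complex.exp (((((k : ℝ) - 1) * d : ℝ) : ℂ) * Complex.I))⁻¹ := by
    rw [← Complex.exp_neg]
    congr 1
    push_cast
    ring
  rw [hexp, mul_inv_eq_iff_eq_mul₀ (Complex.exp_ne_zero _), Complex.exp_mul_I,
    ← Complex.ofReal_cos, ← Complex.ofReal_sin, Complex.ext_iff]
  simp [cval, -Complex.ofReal_cos, -Complex.ofReal_sin]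

/-- A positive combination `a cos ψ + b sin ψ` means that `a + ib` has an argument
within `π/2` of `ψ`. -/
lemma exists_polar_of_pos {a b ψ : ℝ} (h : 0 < Real.cos ψ * a + Real.sin ψ * b) :
    ∃ r φ : ℝ, 0 < r ∧ |φ| < Real.pi / 2 ∧
      a = r * Real.cos (ψ + φ) ∧ b = r * Real.sin (ψ + φ) := by
  set w : ℂ := ⟨Real.cos ψ * a + Real.sin ψ * b, Real.cos ψ * b - Real.sin ψ * a⟩ with hw
  have hre : ‖w‖ * Real.cos w.arg = Real.cos ψ * a + Real.sin ψ * b :=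
    Complex.norm_mul_cos_arg w
  have him : ‖w‖ * Real.sin w.arg = Real.cos ψ * b - Real.sin ψ * a :=
    Complex.norm_mul_sin_arg w
  have hw0 : w ≠ 0 := fun h0 => h.ne' (congrArg Complex.re h0)
  refine ⟨‖w‖, w.arg, norm_pos_iff.mpr hw0,
    Complex.abs_arg_lt_pi_div_two_iff.mpr (Or.inl h), ?_, ?_⟩
  · rw [Real.cos_add]
    linear_combination -Real.cos ψ * hre + Real.sin ψ * him - a * Real.sin_sq_add_cos_sq ψ
  · rw [Real.sin_add]
    linear_combination -Real.sin ψ * hre - Real.cos ψ * him - b * Real.sin_sq_add_cos_sq ψ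

/-- If `θ` is not a Stokes direction and `λ = cos((k−1)θ)·X + sin((k−1)θ)·Y` is the
real part of `e^{−i(k−1)θ}·A₀`, then for every root `α ∈ R`, `α(λ) > 0` iff there is an
anti-Stokes direction `d` supported by `α` with `|d − θ| < π/(2k−2)`. -/
theorem positive_iff_supports_antiStokes_nearby
    {V : Type*} [AddCommGroup V] [Module ℝ V] [FiniteDimensional ℝ V]
    (k : ℕ) (hk : 2 ≤ k)
    (R : Finset (V →ₗ[ℝ] ℝ))
    (hR0 : ∀ α ∈ R, α ≠ 0)
    (hRneg : ∀ α ∈ R, -α ∈ R)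
    (X Y : V)
    (hreg : ∀ α ∈ R, cval X Y α ≠ 0)
    (θ : ℝ) (hθ : ¬ IsStokes k R X Y θ) :
    ∀ α ∈ R,
      0 < α (Real.cos (((k : ℝ) - 1) * θ) • X + Real.sin (((k : ℝ) - 1) * θ) • Y) ↔
      ∃ d : ℝ, Supports k X Y α d ∧ |d - θ| < Real.pi / (2 * (k : ℝ) - 2) := by
  intro α _
  have hk' : (2 : ℝ) ≤ k := by exact_mod_cast hk
  have hm : 0 < (k : ℝ) - 1 := by linarith
  have hwidth : Real.pi / (2 * (k : ℝ) - 2) = Real.pi / 2 / ((k : ℝ) - 1) := by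
    rw [div_div]
    ring_nf
  simp only [map_add, map_smul, smul_eq_mul, supports_iff_polar, hwidth, lt_div_iff₀ hm]
  constructor
  · intro h
    obtain ⟨r, φ, hr, hφ, ha, hb⟩ := exists_polar_of_pos h
    have hd : ((k : ℝ) - 1) * (θ + φ / ((k : ℝ) - 1)) = ((k : ℝ) - 1) * θ + φ := by
      field_simp
    refine ⟨θ + φ / ((k : ℝ) - 1), ⟨r, hr, ?_, ?_⟩, ?_⟩
    · rw [hd, ha]
    · rw [hd, hb]
    · rwa [add_sub_cancel_left, abs_div, abs_of_pos hm, div_mul_cancel₀ _ hm.ne']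
  · rintro ⟨d, ⟨r, hr, ha, hb⟩, hd⟩
    rw [← abs_of_pos hm, ← abs_mul, abs_lt] at hd
    have hcos := Real.cos_pos_of_mem_Ioo ⟨hd.1, hd.2⟩
    have hsub : (d - θ) * ((k : ℝ) - 1) = ((k : ℝ) - 1) * d - ((k : ℝ) - 1) * θ := by ring
    rw [hsub, Real.cos_sub] at hcos
    rw [ha, hb]
    linarith [mul_pos hr hcos]
end

section
/- Suppose θ ∈ ℝ is not a Stokes direction. Define P(θ) := {α ∈ R : there exists an anti-Stokes direction d supported by α with |d − θ| < π/(2k−2)} (the union of the sets of roots supporting the anti-Stokes directions of the half-period centered at θ). Then P(θ) = {α ∈ R : α(λ) > 0} where λ := Re(e^{−i(k−1)θ}·A₀) ∈ t_ℝ is regular; moreover R is the disjoint union of P(θ) and −P(θ). Hence the union of the sets of roots supporting the anti-Stokes directions of a half-period is a system of positive roots in a uniquely determined root ordering. -/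
/-- The roots supporting some anti-Stokes direction of the half-period centered at `θ`. -/
noncomputable def halfPeriodRoots {V : Type*} [AddCommGroup V] [Module ℝ V]
    (k : ℕ) (R : Finset (V →ₗ[ℝ] ℝ)) (X Y : V) (θ : ℝ) : Set (V →ₗ[ℝ] ℝ) :=
  {α | α ∈ R ∧ ∃ d : ℝ, Supports k X Y α d ∧ |d - θ| < Real.pi / (2 * (k : ℝ) - 2)}

/-- Shifting the direction by `s` multiplies the supporting condition by `e^{-i(k-1)s}`. -/
lemma supports_add_iff {V : Type*} [AddCommGroup V] [Module ℝ V]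
    (k : ℕ) (X Y : V) (α : V →ₗ[ℝ] ℝ) (θ s : ℝ) :
    Supports k X Y α (θ + s) ↔ ∃ r : ℝ, 0 < r ∧
      cval X Y α * Complex.exp (-Complex.I * ((k : ℂ) - 1) * (θ : ℂ)) =
        r * Complex.exp (((((k : ℝ) - 1) * s : ℝ) : ℂ) * Complex.I) := by
  have h : Complex.exp (-Complex.I * ((k : ℂ) - 1) * ((θ + s : ℝ) : ℂ)) =
      Complex.exp (-Complex.I * ((k : ℂ) - 1) * (θ : ℂ)) *
        (Complex.exp (((((k : ℝ) - 1) * s : ℝ) : ℂ) * Complex.I))⁻¹ := by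
    rw [← Complex.exp_neg, ← Complex.exp_add]
    congr 1
    push_cast
    ring
  unfold Supports
  simp_rw [h, ← mul_assoc, mul_inv_eq_iff_eq_mul₀ (Complex.exp_ne_zero _)]

/-- The real part of `e^{-i(k-1)θ} α(A₀)` is the value of `α` on `Re (e^{-i(k-1)θ} A₀)`. -/
lemma re_cval_mul_exp {V : Type*} [AddCommGroup V] [Module ℝ V]
    (k : ℕ) (X Y : V) (α : V →ₗ[ℝ] ℝ) (θ : ℝ) :
    (cval X Y α * Complex.exp (-Complex.I * ((k : ℂ) - 1) * (θ : ℂ))).re =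
      α (Real.cos (((k : ℝ) - 1) * θ) • X + Real.sin (((k : ℝ) - 1) * θ) • Y) := by
  have h : -Complex.I * ((k : ℂ) - 1) * (θ : ℂ) =
      ((-(((k : ℝ) - 1) * θ) : ℝ) : ℂ) * Complex.I := by
    push_cast
    ring
  rw [h, Complex.mul_re, Complex.exp_ofReal_mul_I_re, Complex.exp_ofReal_mul_I_im]
  simp [cval]
  ring

/-- A root supports a direction at distance less than `π/(2k-2)` from `θ` exactly when it is
positive on `Re (e^{-i(k-1)θ} A₀)`. -/
lemma exists_supports_iff_pos {V : Type*} [AddCommGroup V] [Module ℝ V]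
    {k : ℕ} (hk : 2 ≤ k) (X Y : V) (α : V →ₗ[ℝ] ℝ) (θ : ℝ) :
    (∃ d : ℝ, Supports k X Y α d ∧ |d - θ| < Real.pi / (2 * (k : ℝ) - 2)) ↔
      0 < α (Real.cos (((k : ℝ) - 1) * θ) • X + Real.sin (((k : ℝ) - 1) * θ) • Y) := by
  have hk' : (0 : ℝ) < (k : ℝ) - 1 := by
    have : (2 : ℝ) ≤ k := by exact_mod_cast hk
    linarith
  have habs (s : ℝ) : |s| < Real.pi / (2 * (k : ℝ) - 2) ↔
      |((k : ℝ) - 1) * s| < Real.pi / 2 := by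
    rw [abs_mul, abs_of_pos hk', lt_div_iff₀ (by linarith), lt_div_iff₀ two_pos]
    ring_nf
  rw [← re_cval_mul_exp]
  constructor
  · rintro ⟨d, hd, hlt⟩
    obtain ⟨s, rfl⟩ : ∃ s, d = θ + s := ⟨d - θ, by ring⟩
    obtain ⟨r, hr, h⟩ := (supports_add_iff k X Y α θ s).1 hd
    rw [add_sub_cancel_left, habs, abs_lt] at hlt
    rw [h, Complex.re_ofReal_mul, Complex.exp_ofReal_mul_I_re]
    exact mul_pos hr (Real.cos_pos_of_mem_Ioo ⟨by linarith, hlt.2⟩)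
  · intro h
    set z := cval X Y α * Complex.exp (-Complex.I * ((k : ℂ) - 1) * (θ : ℂ)) with hz
    have hks : ((k : ℝ) - 1) * (z.arg / ((k : ℝ) - 1)) = z.arg := by field_simp
    refine ⟨θ + z.arg / ((k : ℝ) - 1), (supports_add_iff k X Y α θ _).2 ⟨‖z‖, ?_, ?_⟩, ?_⟩
    · exact norm_pos_iff.2 fun h0 => by simp [h0] at h
    · rw [hks, Complex.norm_mul_exp_arg_mul_I]
    · rw [add_sub_cancel_left, habs, hks, Complex.abs_arg_lt_pi_div_two_iff]
      exact Or.inl h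

/-- At a non-Stokes direction no root vanishes on `Re (e^{-i(k-1)θ} A₀)`. -/
lemma apply_ne_zero_of_not_isStokes {V : Type*} [AddCommGroup V] [Module ℝ V]
    {k : ℕ} (hk : 2 ≤ k) {R : Finset (V →ₗ[ℝ] ℝ)} (hRneg : ∀ α ∈ R, -α ∈ R) {X Y : V}
    (hreg : ∀ α ∈ R, cval X Y α ≠ 0) {θ : ℝ} (hθ : ¬ IsStokes k R X Y θ)
    {α : V →ₗ[ℝ] ℝ} (hα : α ∈ R) :
    α (Real.cos (((k : ℝ) - 1) * θ) • X + Real.sin (((k : ℝ) - 1) * θ) • Y) ≠ 0 := by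
  have hk' : (0 : ℝ) < (k : ℝ) - 1 := by
    have : (2 : ℝ) ≤ k := by exact_mod_cast hk
    linarith
  have key (β : V →ₗ[ℝ] ℝ) (hβ : β ∈ R)
      (him : (cval X Y β * Complex.exp (-Complex.I * ((k : ℂ) - 1) * (θ : ℂ))).im < 0) :
      β (Real.cos (((k : ℝ) - 1) * θ) • X + Real.sin (((k : ℝ) - 1) * θ) • Y) ≠ 0 := by
    intro h0
    rw [← re_cval_mul_exp] at h0
    refine hθ ⟨β, hβ, ?_⟩
    rw [sub_eq_add_neg, supports_add_iff]
    refine ⟨_, neg_pos.2 him, ?_⟩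
    have hs : ((k : ℝ) - 1) * -(Real.pi / (2 * (k : ℝ) - 2)) = -(Real.pi / 2) := by
      rw [show 2 * (k : ℝ) - 2 = 2 * ((k : ℝ) - 1) by ring]
      field_simp
    rw [hs]
    apply Complex.ext
    · rw [h0, Complex.re_ofReal_mul, Complex.exp_ofReal_mul_I_re]
      simp
    · rw [Complex.im_ofReal_mul, Complex.exp_ofReal_mul_I_im]
      simp
  rcases lt_trichotomy
    (cval X Y α * Complex.exp (-Complex.I * ((k : ℂ) - 1) * (θ : ℂ))).im 0 with him | him | him
  · exact key α hα him
  · intro h0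
    rw [← re_cval_mul_exp] at h0
    exact mul_ne_zero (hreg α hα) (Complex.exp_ne_zero _) (Complex.ext h0 him)
  · have hneg : cval X Y (-α) = -cval X Y α := by
      simp [cval]
      ring
    have := key (-α) (hRneg α hα) (by rw [hneg, neg_mul, Complex.neg_im]; linarith)
    rwa [LinearMap.neg_apply, neg_ne_zero] at this

/-- If `θ` is not a Stokes direction, then the set `P(θ)` of roots supporting the
anti-Stokes directions of the half-period centered at `θ` equals the set of roots
positive on the regular element `λ = Re(e^{−i(k−1)θ}·A₀)`, and `R` is the disjoint
union of `P(θ)` and `−P(θ)`: so `P(θ)` is a system of positive roots in a uniquely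
determined root ordering. -/
theorem halfPeriodRoots_positive_system
    {V : Type*} [AddCommGroup V] [Module ℝ V] [FiniteDimensional ℝ V]
    (k : ℕ) (hk : 2 ≤ k)
    (R : Finset (V →ₗ[ℝ] ℝ))
    (hR0 : ∀ α ∈ R, α ≠ 0)
    (hRneg : ∀ α ∈ R, -α ∈ R)
    (X Y : V)
    (hreg : ∀ α ∈ R, cval X Y α ≠ 0)
    (θ : ℝ) (hθ : ¬ IsStokes k R X Y θ) :
    (halfPeriodRoots k R X Y θ =
      {α | α ∈ R ∧
        0 < α (Real.cos (((k : ℝ) - 1) * θ) • X + Real.sin (((k : ℝ) - 1) * θ) • Y)}) ∧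
    (∀ α ∈ R,
      α (Real.cos (((k : ℝ) - 1) * θ) • X + Real.sin (((k : ℝ) - 1) * θ) • Y) ≠ 0) ∧
    (∀ α ∈ R,
      (α ∈ halfPeriodRoots k R X Y θ ∨ -α ∈ halfPeriodRoots k R X Y θ) ∧
      ¬(α ∈ halfPeriodRoots k R X Y θ ∧ -α ∈ halfPeriodRoots k R X Y θ)) := by
  have hmem (α : V →ₗ[ℝ] ℝ) : α ∈ halfPeriodRoots k R X Y θ ↔ α ∈ R ∧
      0 < α (Real.cos (((k : ℝ) - 1) * θ) • X + Real.sin (((k : ℝ) - 1) * θ) • Y) :=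
    and_congr_right fun _ => exists_supports_iff_pos hk X Y α θ
  have hne (α : V →ₗ[ℝ] ℝ) (hα : α ∈ R) := apply_ne_zero_of_not_isStokes hk hRneg hreg hθ hα
  refine ⟨Set.ext hmem, hne, fun α hα => ?_⟩
  simp only [hmem, hα, hRneg α hα, true_and, LinearMap.neg_apply, neg_pos]
  exact ⟨(hne α hα).symm.lt_or_gt, fun h => lt_asymm h.1 h.2⟩
end
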